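/- arXiv:1502.02579 — 3 statements merged into one kernel-verified Lean document; each statement's English description precedes it below -/
import Mathlib

section
/- There exists a function h holomorphic on U = {(x,t) ∈ D_r × ℂ : t ≠ φ(x)} such that h(x,0) = exp(1/x) for every x ∈ D_r with x ≠ 0. (One may take h(x,t) = Σ_{j≥0} ψ(x)^j λ_j(x)/(φ(x)−t)^j, the series being convergent on U.) -/
/-- The series `∑ w ^ (i + 1) / (n * i + a + 1)!` defines an entire function. -/
lemma differentiable_tsum_pow_div_factorial {n : ℕ} (hn : 1 ≤ n) (a : ℕ) :
    Differentiable ℂ fun w : ℂ ↦ ∑' i : ℕ, w ^ (i + 1) / ((i * n + a + 1).factorial : ℂ) := by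
  intro w
  set R : ℝ := ‖w‖ + 1
  have hs : Summable fun i : ℕ ↦ R * (R ^ i / (i.factorial : ℝ)) :=
    (Real.summable_pow_div_factorial R).mul_left R
  have hd : DifferentiableOn ℂ
      (fun w : ℂ ↦ ∑' i : ℕ, w ^ (i + 1) / ((i * n + a + 1).factorial : ℂ))
      (Metric.ball 0 R) := by
    refine Complex.differentiableOn_tsum_of_summable_norm hs (fun i ↦ by fun_prop)
      Metric.isOpen_ball fun i z hz ↦ ?_
    have hz' : ‖z‖ ≤ R := (mem_ball_zero_iff.mp hz).le
    have hfac : (i.factorial : ℝ) ≤ ((i * n + a + 1).factorial : ℝ) := by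
      exact_mod_cast Nat.factorial_le (by nlinarith)
    rw [norm_div, norm_pow, Complex.norm_natCast, ← mul_div_assoc, ← pow_succ']
    gcongr
  exact hd.differentiableAt (Metric.isOpen_ball.mem_nhds (by simp [R]))

/-- The exponential series, split according to the residue class of the exponent minus one. -/
lemma one_add_sum_tsum_pow_div_factorial {n : ℕ} (hn : 1 ≤ n) (y : ℂ) :
    1 + ∑ a : Fin n, ∑' i : ℕ, y ^ (i * n + a + 1) / ((i * n + a + 1).factorial : ℂ) =
      Complex.exp y := by
  have : NeZero n := ⟨by omega⟩
  have h₀ : HasSum (fun m : ℕ ↦ y ^ m / (m.factorial : ℂ)) (Complex.exp y) := by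
    rw [Complex.exp_eq_exp_ℂ]
    exact NormedSpace.expSeries_div_hasSum_exp y
  have h₁ : HasSum (fun m : ℕ ↦ y ^ (m + 1) / ((m + 1).factorial : ℂ)) (Complex.exp y - 1) := by
    simpa using (hasSum_nat_add_iff' 1).mpr h₀
  have h₂ : HasSum (fun p : Fin n × ℕ ↦
      y ^ (p.2 * n + p.1 + 1) / ((p.2 * n + p.1 + 1).factorial : ℂ)) (Complex.exp y - 1) := by
    rw [← ((Equiv.prodComm (Fin n) ℕ).trans (Nat.divModEquiv n).symm).hasSum_iff] at h₁
    simpa only [Function.comp_def, Equiv.trans_apply, Equiv.prodComm_apply, Nat.divModEquiv_symm_apply,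
      Prod.fst_swap, Prod.snd_swap] using h₁
  have h₃ := h₂.prod_fiberwise fun a ↦ (h₂.summable.prod_factor a).hasSum
  rw [(hasSum_fintype _).unique h₃]
  ring


/-- With `D_r` the disc of radius `r`, `ψ` holomorphic and nonvanishing on `D_r`,
`φ(x) = xⁿ ψ(x)` (`n ≥ 1`), and `U = {(x,t) ∈ D_r × ℂ : t ≠ φ(x)}`, there exists a function `h`
holomorphic on `U` such that `h(x,0) = exp (1/x)` for every `x ∈ D_r` with `x ≠ 0`. -/
theorem stmt_1 (r : ℝ) (hr : 0 < r) (n : ℕ) (hn : 1 ≤ n)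
    (ψ : ℂ → ℂ) (hψ : DifferentiableOn ℂ ψ (Metric.ball (0 : ℂ) r))
    (hψ0 : ∀ x ∈ Metric.ball (0 : ℂ) r, ψ x ≠ 0)
    (φ : ℂ → ℂ) (hφ : ∀ x : ℂ, φ x = x ^ n * ψ x)
    (U : Set (ℂ × ℂ))
    (hU : U = {p : ℂ × ℂ | p.1 ∈ Metric.ball (0 : ℂ) r ∧ p.2 ≠ φ p.1}) :
    ∃ h : ℂ × ℂ → ℂ, DifferentiableOn ℂ h U ∧
      ∀ x ∈ Metric.ball (0 : ℂ) r, x ≠ 0 → h (x, 0) = Complex.exp (1 / x) := by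
  subst hU
  refine ⟨fun p ↦ 1 + ∑ a : Fin n, p.1 ^ (n - 1 - (a : ℕ)) *
    ∑' i : ℕ, (ψ p.1 / (φ p.1 - p.2)) ^ (i + 1) / ((i * n + a + 1).factorial : ℂ), ?_, ?_⟩
  · set U : Set (ℂ × ℂ) := {p | p.1 ∈ Metric.ball (0 : ℂ) r ∧ p.2 ≠ φ p.1}
    have hψU : DifferentiableOn ℂ (fun p : ℂ × ℂ ↦ ψ p.1) U :=
      hψ.comp differentiableOn_fst fun p hp ↦ hp.1
    have hw : DifferentiableOn ℂ (fun p : ℂ × ℂ ↦ ψ p.1 / (φ p.1 - p.2)) U := by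
      simp only [div_eq_mul_inv]
      refine hψU.mul (DifferentiableOn.fun_inv ?_ fun p (hp : p ∈ U) ↦ sub_ne_zero.mpr hp.2.symm)
      simp only [hφ]
      exact ((differentiableOn_fst.pow n).mul hψU).sub differentiableOn_snd
    refine (differentiableOn_const 1).add (DifferentiableOn.fun_sum fun a _ ↦ ?_)
    exact (differentiableOn_fst.pow _).mul
      ((differentiable_tsum_pow_div_factorial hn a).comp_differentiableOn hw)
  · intro x hx hx0
    have hw : ψ x / (φ x - 0) = (1 / x) ^ n := by
      have := hψ0 x hx
      rw [hφ, sub_zero, one_div, inv_pow]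
      field_simp
    rw [← one_add_sum_tsum_pow_div_factorial hn (1 / x)]
    simp only [hw, ← tsum_mul_left]
    refine congrArg (1 + ·) (Finset.sum_congr rfl fun a _ ↦ tsum_congr fun i ↦ ?_)
    obtain ⟨a, ha⟩ := a
    have he : n * (i + 1) = (n - 1 - a) + (i * n + a + 1) := by
      have : n * (i + 1) = i * n + n := by ring
      omega
    rw [← pow_mul, he, pow_add, mul_div_assoc, ← mul_assoc, ← mul_pow, mul_one_div_cancel hx0,
      one_pow, one_mul]
end

section
/- There exist functions h and g, both holomorphic on U = {(x,t) ∈ D_r × ℂ : t ≠ φ(x)}, such that h(x,0) = exp(1/x) for every x ∈ D_r with x ≠ 0, and t·g(x,t) = x²·(∂h/∂x)(x,t) + h(x,t) for all (x,t) ∈ U. (That is, the function P h, where P = x²∂_x + 1, vanishes on {t = 0} ∩ U and hence is divisible by t in the holomorphic functions on U.) -/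
/-- A quotient of scalar-valued differentiable functions on a normed space is differentiable
where the denominator does not vanish. -/
theorem DifferentiableOn.div_of_normedSpace {𝕜 E : Type*} [NontriviallyNormedField 𝕜]
    [NormedAddCommGroup E] [NormedSpace 𝕜 E] {f g : E → 𝕜} {s : Set E}
    (hf : DifferentiableOn 𝕜 f s) (hg : DifferentiableOn 𝕜 g s) (h0 : ∀ x ∈ s, g x ≠ 0) :
    DifferentiableOn 𝕜 (fun x => f x / g x) s := by
  simp only [div_eq_mul_inv]
  exact hf.mul (hg.inv h0)


/-- With `D_r`, `ψ`, `φ(x) = xⁿ ψ(x)` and `U = {(x,t) ∈ D_r × ℂ : t ≠ φ(x)}` as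
before, there exist `h` and `g`, both holomorphic on `U`, such that `h(x,0) = exp (1/x)` for
every `x ∈ D_r` with `x ≠ 0`, and `t · g(x,t) = x² · (∂h/∂x)(x,t) + h(x,t)` on `U`
(i.e. `P h` with `P = x²∂ₓ + 1` vanishes on `{t = 0} ∩ U`, hence is divisible by `t`). -/
theorem stmt_2 (r : ℝ) (hr : 0 < r) (n : ℕ) (hn : 1 ≤ n)
    (ψ : ℂ → ℂ) (hψ : DifferentiableOn ℂ ψ (Metric.ball (0 : ℂ) r))
    (hψ0 : ∀ x ∈ Metric.ball (0 : ℂ) r, ψ x ≠ 0)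
    (φ : ℂ → ℂ) (hφ : ∀ x : ℂ, φ x = x ^ n * ψ x)
    (U : Set (ℂ × ℂ))
    (hU : U = {p : ℂ × ℂ | p.1 ∈ Metric.ball (0 : ℂ) r ∧ p.2 ≠ φ p.1}) :
    ∃ h g : ℂ × ℂ → ℂ, DifferentiableOn ℂ h U ∧ DifferentiableOn ℂ g U ∧
      (∀ x ∈ Metric.ball (0 : ℂ) r, x ≠ 0 → h (x, 0) = Complex.exp (1 / x)) ∧
      ∀ p ∈ U, p.2 * g p = p.1 ^ 2 * deriv (fun y : ℂ => h (y, p.2)) p.1 + h p := by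
  subst hU
  obtain ⟨m, rfl⟩ : ∃ m, n = m + 1 := ⟨n - 1, by omega⟩
  let a : ℂ → ℂ := fun x => x ^ m * ψ x
  have hφa : ∀ x, φ x = x * a x := fun x => by simp only [hφ, a]; ring
  have ha : DifferentiableOn ℂ a (Metric.ball (0 : ℂ) r) :=
    (differentiable_id.pow m).differentiableOn.mul hψ
  have ha' : DifferentiableOn ℂ (deriv a) (Metric.ball (0 : ℂ) r) :=
    ha.deriv Metric.isOpen_ball
  let U : Set (ℂ × ℂ) := {p | p.1 ∈ Metric.ball (0 : ℂ) r ∧ p.2 ≠ φ p.1}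
  have hmaps : Set.MapsTo Prod.fst U (Metric.ball (0 : ℂ) r) := fun p hp => hp.1
  have hx : DifferentiableOn ℂ (fun p : ℂ × ℂ => p.1) U := differentiableOn_fst
  have ht : DifferentiableOn ℂ (fun p : ℂ × ℂ => p.2) U := differentiableOn_snd
  have hA : DifferentiableOn ℂ (fun p : ℂ × ℂ => a p.1) U := ha.comp hx hmaps
  have hA' : DifferentiableOn ℂ (fun p : ℂ × ℂ => deriv a p.1) U := ha'.comp hx hmaps
  have hne : ∀ p ∈ U, p.1 * a p.1 - p.2 ≠ 0 := fun p hp h =>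
    hp.2 (by rw [hφa]; exact (sub_eq_zero.mp h).symm)
  have hden : DifferentiableOn ℂ (fun p : ℂ × ℂ => p.1 * a p.1 - p.2) U := (hx.mul hA).sub ht
  have hh : DifferentiableOn ℂ
      (fun p : ℂ × ℂ => Complex.exp (a p.1 / (p.1 * a p.1 - p.2))) U :=
    (hA.div_of_normedSpace hden hne).cexp
  refine ⟨fun p => Complex.exp (a p.1 / (p.1 * a p.1 - p.2)),
    fun p => Complex.exp (a p.1 / (p.1 * a p.1 - p.2)) *
      ((p.2 - p.1 ^ 2 * deriv a p.1 - 2 * (p.1 * a p.1)) / (p.1 * a p.1 - p.2) ^ 2),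
    hh, ?_, ?_, ?_⟩
  · exact hh.mul (((ht.sub ((hx.pow 2).mul hA')).sub ((hx.mul hA).const_mul 2)).div_of_normedSpace
      (hden.pow 2) fun p hp => pow_ne_zero 2 (hne p hp))
  · intro x hxr hx0
    have hax : a x ≠ 0 := mul_ne_zero (pow_ne_zero m hx0) (hψ0 x hxr)
    simp only [sub_zero]
    field_simp
  · rintro ⟨x, t⟩ hp
    have hd : x * a x - t ≠ 0 := hne (x, t) hp
    have hax : HasDerivAt a (deriv a x) x :=
      (ha.differentiableAt (Metric.isOpen_ball.mem_nhds hp.1)).hasDerivAt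
    have hder := (hax.div (((hasDerivAt_id x).mul hax).sub_const t) hd).cexp
    have hderiv : deriv (fun y : ℂ => Complex.exp (a y / (y * a y - t))) x =
        Complex.exp (a x / (x * a x - t)) *
          ((deriv a x * (x * a x - t) - a x * (1 * a x + x * deriv a x)) /
            (x * a x - t) ^ 2) := hder.deriv
    simp only [hderiv]
    generalize Complex.exp (a x / (x * a x - t)) = E
    field_simp
    ring
end

section
/- Let h be holomorphic on U = {(x,t) ∈ D_r × ℂ : t ≠ φ(x)} with h(x,0) = exp(1/x) for all x ∈ D_r ∖ {0}. Then there do not exist a natural number k, a function f holomorphic on U, and a function R holomorphic on D_r × ℂ, such that (φ(x) − t)^k · ( t·f(x,t) − h(x,t) ) = R(x,t) for all (x,t) ∈ U. (That is, the equation t·f = h has no solution f modulo functions meromorphic with poles along the curve {t = φ(x)}; this is the obstruction showing Ext¹ with values in B^∞/B does not vanish.) -/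
/-- With `D_r`, `ψ` holomorphic and nonvanishing, `φ(x) = xⁿ ψ(x)` (`n ≥ 1`)
and `U = {(x,t) ∈ D_r × ℂ : t ≠ φ(x)}`, let `h` be holomorphic on `U` with
`h(x,0) = exp (1/x)` for `x ∈ D_r ∖ {0}`. Then there do not exist `k : ℕ`, `f` holomorphic on
`U` and `R` holomorphic on `D_r × ℂ` such that
`(φ(x) − t)^k · (t·f(x,t) − h(x,t)) = R(x,t)` on `U`: the equation `t·f = h` has no solution
modulo functions meromorphic with poles along `{t = φ(x)}`. -/
theorem stmt_11 (r : ℝ) (hr : 0 < r) (n : ℕ) (hn : 1 ≤ n)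
    (ψ : ℂ → ℂ) (hψ : DifferentiableOn ℂ ψ (Metric.ball (0 : ℂ) r))
    (hψ0 : ∀ x ∈ Metric.ball (0 : ℂ) r, ψ x ≠ 0)
    (φ : ℂ → ℂ) (hφ : ∀ x : ℂ, φ x = x ^ n * ψ x)
    (U : Set (ℂ × ℂ))
    (hU : U = {p : ℂ × ℂ | p.1 ∈ Metric.ball (0 : ℂ) r ∧ p.2 ≠ φ p.1})
    (h : ℂ × ℂ → ℂ) (hh : DifferentiableOn ℂ h U)
    (hh0 : ∀ x ∈ Metric.ball (0 : ℂ) r, x ≠ 0 → h (x, 0) = Complex.exp (1 / x)) :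
    ¬ ∃ (k : ℕ) (f R : ℂ × ℂ → ℂ),
        DifferentiableOn ℂ f U ∧
        DifferentiableOn ℂ R (Metric.ball (0 : ℂ) r ×ˢ (Set.univ : Set ℂ)) ∧
        ∀ p ∈ U, (φ p.1 - p.2) ^ k * (p.2 * f p - h p) = R p := by
  rintro ⟨k, f, R, -, hR, hfR⟩
  have h0 : (0 : ℂ) ∈ Metric.ball (0 : ℂ) r := Metric.mem_ball_self hr
  have hinv : Filter.Tendsto (fun y : ℝ => ((y⁻¹ : ℝ) : ℂ)) Filter.atTop (nhds 0) := by
    simpa only [Complex.ofReal_zero, Function.comp_def] using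
      (Complex.continuous_ofReal.tendsto 0).comp (tendsto_inv_atTop_zero (𝕜 := ℝ))
  have hRc : ContinuousAt R ((0 : ℂ), (0 : ℂ)) :=
    (hR.differentiableAt ((Metric.isOpen_ball.prod isOpen_univ).mem_nhds
      ⟨h0, Set.mem_univ _⟩)).continuousAt
  have hψc : ContinuousAt ψ 0 :=
    (hψ.differentiableAt (Metric.isOpen_ball.mem_nhds h0)).continuousAt
  have hRlim := (hRc.tendsto.comp (hinv.prodMk_nhds (tendsto_const_nhds (x := (0 : ℂ))))).norm
  have hψlim := ((hψc.tendsto.comp hinv).pow k).norm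
  have hquot := hRlim.div hψlim (norm_ne_zero_iff.2 (pow_ne_zero k (hψ0 0 h0)))
  refine not_tendsto_nhds_of_tendsto_atTop (Real.tendsto_exp_div_pow_atTop (n * k)) _
    (hquot.congr' ?_)
  filter_upwards [hinv.eventually (Metric.isOpen_ball.mem_nhds h0),
    Filter.eventually_gt_atTop 0] with y hy hypos
  have hx0 : ((y⁻¹ : ℝ) : ℂ) ≠ 0 := Complex.ofReal_ne_zero.2 (inv_ne_zero hypos.ne')
  have hψy : ψ ((y⁻¹ : ℝ) : ℂ) ≠ 0 := hψ0 _ hy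
  have hmem : (((y⁻¹ : ℝ) : ℂ), (0 : ℂ)) ∈ U := by
    rw [hU]
    refine ⟨hy, ?_⟩
    simp only [hφ]
    exact (mul_ne_zero (pow_ne_zero n hx0) hψy).symm
  have hval := hfR _ hmem
  simp only [hh0 _ hy hx0, hφ, sub_zero, zero_mul, zero_sub] at hval
  have hexp : ‖Complex.exp (1 / ((y⁻¹ : ℝ) : ℂ))‖ = Real.exp y := by
    rw [Complex.norm_exp, one_div, ← Complex.ofReal_inv, inv_inv, Complex.ofReal_re]
  have hnorm : ‖((y⁻¹ : ℝ) : ℂ)‖ = y⁻¹ := by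
    rw [Complex.norm_real, Real.norm_of_nonneg (inv_nonneg.2 hypos.le)]
  have hψk : ‖ψ ((y⁻¹ : ℝ) : ℂ)‖ ≠ 0 := norm_ne_zero_iff.2 hψy
  simp only [Pi.div_apply, Function.comp_apply]
  rw [← hval, norm_mul, norm_neg, hexp, norm_pow, norm_pow, norm_mul, norm_pow, hnorm,
    mul_pow, ← pow_mul, inv_pow, mul_right_comm, mul_div_assoc, div_self (pow_ne_zero k hψk),
    mul_one, mul_comm, div_eq_mul_inv]
end
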